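/- arXiv:1502.07926 — 2 statements merged into one kernel-verified Lean document; each statement's English description precedes it below -/
import Mathlib

section
/- Consider the system x(k+1) = Φ x(k) + Ẽ f(k), r(k) = C x(k) + G f(k), with Φ ∈ ℝ^{n×n}, Ẽ ∈ ℝ^{n×n_f}, C ∈ ℝ^{n_y×n}, G ∈ ℝ^{n_y×n_f}. Suppose the fault Markov parameters satisfy H_j^f = 0 for all 0 ≤ j ≤ τ−1, and let M ∈ ℝ^{n_f×n_y} be a left inverse of H_τ^f, i.e. M H_τ^f = I_{n_f}. Define K_d = Φ − Ẽ M C Φ^τ. If the outputs vanish at times τ, τ+1, …, L (with L ≥ τ), then for every 0 ≤ i ≤ L − τ the state and input are forced to satisfy x(i+1) = K_d x(i) and f(i) = − M C Φ^τ K_d^{i} x(0). -/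
open Matrix

/-- If the Markov parameters below index `j` vanish, then the output `j` steps ahead depends only
on the current state and the current input. -/
theorem output_eq_of_markov_eq_zero {n nf ny : ℕ}
    {Phi : Matrix (Fin n) (Fin n) ℝ} {Et : Matrix (Fin n) (Fin nf) ℝ}
    {C : Matrix (Fin ny) (Fin n) ℝ} {G : Matrix (Fin ny) (Fin nf) ℝ}
    {Hf : ℕ → Matrix (Fin ny) (Fin nf) ℝ}
    (hHf : ∀ i, Hf i = if i = 0 then G else C * Phi ^ (i - 1) * Et)
    {x : ℕ → Fin n → ℝ} {f : ℕ → Fin nf → ℝ} {r : ℕ → Fin ny → ℝ}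
    (hx : ∀ k, x (k + 1) = Phi *ᵥ x k + Et *ᵥ f k)
    (hr : ∀ k, r k = C *ᵥ x k + G *ᵥ f k)
    (j : ℕ) (hzero : ∀ i < j, Hf i = 0) (k : ℕ) :
    r (k + j) = (C * Phi ^ j) *ᵥ x k + Hf j *ᵥ f k := by
  induction j generalizing k with
  | zero => simp [hHf, hr]
  | succ j ih =>
    have h := ih (fun i hi => hzero i (by omega)) (k + 1)
    rw [hzero j (by omega), zero_mulVec, add_zero, hx] at h
    rw [show k + (j + 1) = k + 1 + j by omega, h, hHf (j + 1)]
    simp [mulVec_add, mulVec_mulVec, pow_succ, Matrix.mul_assoc]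

/-- Zero-dynamics characterization: if the outputs of the fault subsystem vanish at
times `τ, …, L`, then the state and input satisfy `x(i+1) = K_d x(i)` and
`f(i) = −M C Φ^τ K_d^i x(0)` for `0 ≤ i ≤ L − τ`, where `K_d = Φ − Ẽ M C Φ^τ` and
`M` is a left inverse of `H_τ^f`. -/
theorem stmt_7 {n nf ny : ℕ}
    (Phi : Matrix (Fin n) (Fin n) ℝ) (Et : Matrix (Fin n) (Fin nf) ℝ)
    (C : Matrix (Fin ny) (Fin n) ℝ) (G : Matrix (Fin ny) (Fin nf) ℝ)
    (τ L : ℕ) (hτL : τ ≤ L)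
    (Hf : ℕ → Matrix (Fin ny) (Fin nf) ℝ)
    (hHf : ∀ i, Hf i = if i = 0 then G else C * Phi ^ (i - 1) * Et)
    (hzero : ∀ j < τ, Hf j = 0)
    (M : Matrix (Fin nf) (Fin ny) ℝ) (hM : M * Hf τ = 1)
    (x : ℕ → Fin n → ℝ) (f : ℕ → Fin nf → ℝ) (r : ℕ → Fin ny → ℝ)
    (hx : ∀ k, x (k + 1) = Phi *ᵥ x k + Et *ᵥ f k)
    (hr : ∀ k, r k = C *ᵥ x k + G *ᵥ f k)
    (hvanish : ∀ i, τ ≤ i → i ≤ L → r i = 0) :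
    ∀ i ≤ L - τ,
      x (i + 1) = (Phi - Et * M * C * Phi ^ τ) *ᵥ x i ∧
        f i = -((M * C * Phi ^ τ * (Phi - Et * M * C * Phi ^ τ) ^ i) *ᵥ x 0) := by
  have hf : ∀ i ≤ L - τ, f i = -((M * C * Phi ^ τ) *ᵥ x i) := by
    intro i hi
    have h := output_eq_of_markov_eq_zero hHf hx hr τ hzero i
    rw [hvanish (i + τ) (by omega) (by omega)] at h
    have h' := congrArg (M *ᵥ ·) h
    simp only [mulVec_zero, mulVec_add, mulVec_mulVec, hM, one_mulVec] at h'
    rw [Matrix.mul_assoc]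
    exact eq_neg_of_add_eq_zero_right h'.symm
  have hstep : ∀ i ≤ L - τ, x (i + 1) = (Phi - Et * M * C * Phi ^ τ) *ᵥ x i := by
    intro i hi
    rw [hx, hf i hi, mulVec_neg, mulVec_mulVec, sub_mulVec, sub_eq_add_neg]
    simp only [Matrix.mul_assoc]
  have hpow : ∀ i ≤ L - τ, x i = (Phi - Et * M * C * Phi ^ τ) ^ i *ᵥ x 0 := by
    intro i
    induction i with
    | zero => simp
    | succ i ih =>
      intro hi
      rw [hstep i (by omega), ih (by omega), mulVec_mulVec, pow_succ']
  intro i hi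
  refine ⟨hstep i hi, ?_⟩
  rw [hf i hi, hpow i hi, mulVec_mulVec]
end

section
/- Let Π be a q×q real positive definite matrix and G₀ an n_f×q real matrix, and for γ² ∈ ℝ define the set Ω_f = { G ∈ ℝ^{n_f×q} : (G − G₀) Π (G − G₀)ᵀ ⪯ G₀ Π G₀ᵀ − I_{n_f} + γ² I_{n_f} }. Then: (a) Ω_f is nonempty if and only if γ² ≥ 1 − λ_min(G₀ Π G₀ᵀ), where λ_min denotes the smallest eigenvalue; and (b) the zero matrix belongs to Ω_f if and only if γ² ≥ 1. Hence Ω_f is nonempty and excludes the zero matrix exactly when 1 − λ_min(G₀ Π G₀ᵀ) ≤ γ² < 1. -/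
open Matrix

/-- The ellipsoid `Ω_f` defined by the bias constraint of the offline mixed-norm problem. -/
def OmegaF {nf q : ℕ} (Pi : Matrix (Fin q) (Fin q) ℝ) (G₀ : Matrix (Fin nf) (Fin q) ℝ)
    (gsq : ℝ) : Set (Matrix (Fin nf) (Fin q) ℝ) :=
  {G | (G₀ * Pi * G₀ᵀ - 1 + gsq • (1 : Matrix (Fin nf) (Fin nf) ℝ) -
      (G - G₀) * Pi * (G - G₀)ᵀ).PosSemidef}

/-- Shifting a Hermitian matrix by a multiple of the identity makes it positive semidefinite
exactly when it makes all the eigenvalues nonnegative. -/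
theorem Matrix.IsHermitian.posSemidef_add_smul_one_iff {n : Type*} [Fintype n] [DecidableEq n]
    {A : Matrix n n ℝ} (hA : A.IsHermitian) (c : ℝ) :
    (A + c • (1 : Matrix n n ℝ)).PosSemidef ↔ ∀ i, 0 ≤ hA.eigenvalues i + c := by
  have hH : (A + c • (1 : Matrix n n ℝ)).IsHermitian :=
    hA.add (by simp [Matrix.IsHermitian])
  rw [posSemidef_iff_isHermitian_and_spectrum_nonneg, and_iff_right hH,
    ← Algebra.algebraMap_eq_smul_one, ← spectrum.add_singleton_eq,
    hA.spectrum_real_eq_range_eigenvalues, Set.add_singleton, ← Set.range_comp,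
    Set.range_subset_iff]
  rfl

/-- A multiple of the identity of positive size is positive semidefinite iff the scalar is
nonnegative. -/
theorem Matrix.posSemidef_smul_one_iff {n : Type*} [Fintype n] [DecidableEq n] [Nonempty n]
    (c : ℝ) : (c • (1 : Matrix n n ℝ)).PosSemidef ↔ 0 ≤ c := by
  refine ⟨fun h => ?_, fun h => PosSemidef.one.smul h⟩
  simpa using h.diag_nonneg (i := Classical.arbitrary n)

theorem zero_mem_OmegaF_iff {nf q : ℕ} [NeZero nf] (Pi : Matrix (Fin q) (Fin q) ℝ)
    (G₀ : Matrix (Fin nf) (Fin q) ℝ) (gsq : ℝ) :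
    (0 : Matrix (Fin nf) (Fin q) ℝ) ∈ OmegaF Pi G₀ gsq ↔ 1 ≤ gsq := by
  have h : G₀ * Pi * G₀ᵀ - 1 + gsq • (1 : Matrix (Fin nf) (Fin nf) ℝ) -
      (0 - G₀) * Pi * (0 - G₀)ᵀ = (gsq - 1) • 1 := by
    simp only [zero_sub, transpose_neg, Matrix.neg_mul, Matrix.mul_neg, neg_neg, sub_smul, one_smul]
    abel
  rw [OmegaF, Set.mem_ofPred_eq, h, posSemidef_smul_one_iff, sub_nonneg]

/-- `Ω_f` is nonempty iff it contains its center. -/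
theorem OmegaF_nonempty_iff {nf q : ℕ} [NeZero nf] {Pi : Matrix (Fin q) (Fin q) ℝ}
    (hPi : Pi.PosSemidef) (G₀ : Matrix (Fin nf) (Fin q) ℝ) (gsq : ℝ)
    (hS : (G₀ * Pi * G₀ᵀ).IsHermitian) :
    (OmegaF Pi G₀ gsq).Nonempty ↔ 1 - (⨅ i, hS.eigenvalues i) ≤ gsq := by
  have hcenter : (OmegaF Pi G₀ gsq).Nonempty ↔
      (G₀ * Pi * G₀ᵀ + (gsq - 1) • (1 : Matrix (Fin nf) (Fin nf) ℝ)).PosSemidef := by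
    have hshift : G₀ * Pi * G₀ᵀ + (gsq - 1) • (1 : Matrix (Fin nf) (Fin nf) ℝ) =
        G₀ * Pi * G₀ᵀ - 1 + gsq • 1 := by
      rw [sub_smul, one_smul]
      abel
    rw [hshift]
    constructor
    · rintro ⟨G, hG⟩
      have hq := hPi.mul_mul_conjTranspose_same (G - G₀)
      rw [conjTranspose_eq_transpose_of_trivial] at hq
      simpa using PosSemidef.add hG hq
    · exact fun h => ⟨G₀, by simpa [OmegaF] using h⟩
  rw [hcenter, hS.posSemidef_add_smul_one_iff, sub_le_comm,
    le_ciInf_iff (Set.finite_range _).bddBelow]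
  exact forall_congr' fun i => ⟨fun h => by linarith, fun h => by linarith⟩

/-- (a) `Ω_f` is nonempty iff `γ² ≥ 1 − λ_min(G₀ Π G₀ᵀ)`; (b) `0 ∈ Ω_f` iff `γ² ≥ 1`.
Hence `Ω_f` is nonempty and excludes the zero matrix exactly when
`1 − λ_min(G₀ Π G₀ᵀ) ≤ γ² < 1`. -/
theorem stmt_12 {nf q : ℕ} (hnf : 0 < nf)
    (Pi : Matrix (Fin q) (Fin q) ℝ) (hPi : Pi.PosDef)
    (G₀ : Matrix (Fin nf) (Fin q) ℝ) (gsq : ℝ)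
    (hS : (G₀ * Pi * G₀ᵀ).IsHermitian) :
    ((OmegaF Pi G₀ gsq).Nonempty ↔ 1 - (⨅ i, hS.eigenvalues i) ≤ gsq) ∧
      ((0 : Matrix (Fin nf) (Fin q) ℝ) ∈ OmegaF Pi G₀ gsq ↔ 1 ≤ gsq) ∧
      (((OmegaF Pi G₀ gsq).Nonempty ∧ (0 : Matrix (Fin nf) (Fin q) ℝ) ∉ OmegaF Pi G₀ gsq) ↔
        (1 - (⨅ i, hS.eigenvalues i) ≤ gsq ∧ gsq < 1)) := by
  have : NeZero nf := ⟨hnf.ne'⟩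
  have ha := OmegaF_nonempty_iff hPi.posSemidef G₀ gsq hS
  have hb := zero_mem_OmegaF_iff Pi G₀ gsq
  exact ⟨ha, hb, and_congr ha (by rw [hb, not_le])⟩
end
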